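/- arXiv:1809.01128 — 2 statements merged into one kernel-verified Lean document; each statement's English description precedes it below -/
import Mathlib

section
/- Let l ≥ 5 and let H1, …, Hl be pairwise disjoint connected simple graphs with xi ∈ V(Hi), |V(Hi)| ≥ 2 and mi = |E(Hi)| ≥ 1, such that m1 = max{m1, …, ml}. Let G be obtained from the cycle C_l = v1v2⋯v_l v1 and H1, …, Hl by identifying xi with vi for i = 1, …, l, and let G' = G − v1v_l + v_{l−2}v_l (so the l-cycle is replaced by an (l−1)-cycle with a triangle at one end). Then W_e(G) < W_e(G'). -/
open SimpleGraph Finset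
open scoped Classical

/-- The distance `d_G(f,g)` between two edges: `0` if they coincide, otherwise the minimum
distance between endpoints plus one (i.e. the distance in the line graph). -/
noncomputable def eDist {V : Type*} (G : SimpleGraph V) (e f : Sym2 V) : ℕ :=
  if e = f then 0 else sInf {n : ℕ | ∃ u ∈ e, ∃ w ∈ f, G.dist u w = n} + 1

/-- The distance `d_G(v,f)` between a vertex and an edge: the minimum distance to an endpoint. -/
noncomputable def vDist {V : Type*} (G : SimpleGraph V) (v : V) (e : Sym2 V) : ℕ :=
  sInf {n : ℕ | ∃ u ∈ e, G.dist v u = n}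

/-- The edge-Wiener index `W_e(G)`: the sum of `eDist` over unordered pairs of edges. -/
noncomputable def edgeWiener {V : Type*} [Fintype V] (G : SimpleGraph V) : ℕ :=
  (∑ e ∈ G.edgeFinset, ∑ f ∈ G.edgeFinset, eDist G e f) / 2

namespace EW

set_option linter.unusedTactic false
set_option linter.unreachableTactic false

/-- distance on the cycle -/
def cd (l i j : ℕ) : ℕ := min ((i - j) + (j - i)) (l - ((i - j) + (j - i)))
def ps (l i : ℕ) : ℕ := if i = l - 1 then l - 2 else i
/-- distance on the path with a triangle at the end -/
def cd' (l i j : ℕ) : ℕ :=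
  if i = j then 0 else if ps l i = ps l j then 1 else (ps l i - ps l j) + (ps l j - ps l i)
def nx (l k : ℕ) : ℕ := if k = l - 1 then 0 else k + 1
def lo (l k : ℕ) : ℕ := if k = l - 1 then l - 3 else k
def hi (l k : ℕ) : ℕ := if k = l - 1 then l - 1 else k + 1
def cv (l i k : ℕ) : ℕ := min (cd l i k) (cd l i (nx l k))
def cv' (l i k : ℕ) : ℕ := min (cd' l i (lo l k)) (cd' l i (hi l k))
def ce (l k q : ℕ) : ℕ := if k = q then 0 else min (cv l k q) (cv l (nx l k) q) + 1
def ce' (l k q : ℕ) : ℕ := if k = q then 0 else min (cv' l (lo l k) q) (cv' l (hi l k) q) + 1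

lemma dsum (N : ℕ) (f : ℕ → ℕ → ℤ) :
    ∑ i ∈ range (N+1), ∑ j ∈ range (N+1), f i j =
      ∑ i ∈ range N, ∑ j ∈ range N, f i j + ∑ i ∈ range N, f i N + ∑ j ∈ range N, f N j + f N N := by
  simp only [Finset.sum_range_succ, Finset.sum_add_distrib]; ring

lemma num1 (n : ℕ) (m : ℕ → ℤ) (h1 : ∀ i < n+5, 1 ≤ m i) (hm : ∀ i < n+5, m i ≤ m 0) :
    2 ≤ ∑ i ∈ range (n+5), ∑ j ∈ range (n+5), m i * m j * ((cd' (n+5) i j : ℤ) - cd (n+5) i j) := by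
  rw [show n + 5 = (n+4)+1 from rfl, dsum]
  have a0 : 0 ≤ ∑ i ∈ range (n+4), ∑ j ∈ range (n+4),
      m i * m j * ((cd' (n+4+1) i j : ℤ) - cd (n+4+1) i j) := by
    refine Finset.sum_nonneg fun i hi => Finset.sum_nonneg fun j hj => ?_
    rw [Finset.mem_range] at hi hj
    have := h1 i (by omega)
    have := h1 j (by omega)
    have : (0:ℤ) ≤ (cd' (n+4+1) i j : ℤ) - cd (n+4+1) i j := by
      unfold cd' cd ps; split_ifs <;> omega
    positivity
  have key : m 0 ≤ ∑ j ∈ range (n+4), m j * ((cd' (n+5) (n+4) j : ℤ) - cd (n+5) (n+4) j) := by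
    rw [Finset.sum_range_succ, Finset.sum_range_succ', Finset.sum_range_succ']
    have e0 : ((cd' (n+5) (n+4) 0 : ℤ) - cd (n+5) (n+4) 0) = n+2 := by
      have x1 : cd' (n+5) (n+4) 0 = n+3 := by
        unfold cd' ps; split_ifs <;> omega
      have x2 : cd (n+5) (n+4) 0 = 1 := by
        unfold cd; omega
      rw [x1, x2]; push_cast; ring
    have e1 : 0 ≤ ((cd' (n+5) (n+4) (0+1) : ℤ) - cd (n+5) (n+4) (0+1)) := by
      unfold cd' cd ps; split_ifs <;> omega
    have e2 : 0 ≤ ((cd' (n+5) (n+4) (n+3) : ℤ) - cd (n+5) (n+4) (n+3)) := by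
      unfold cd' cd ps; split_ifs <;> omega
    have e3 : ∑ j ∈ range (n+1), (- m 0) ≤ ∑ j ∈ range (n+1),
        m (j+1+1) * ((cd' (n+5) (n+4) (j+1+1) : ℤ) - cd (n+5) (n+4) (j+1+1)) := by
      refine Finset.sum_le_sum fun j hj => ?_
      rw [Finset.mem_range] at hj
      have : -1 ≤ ((cd' (n+5) (n+4) (j+1+1) : ℤ) - cd (n+5) (n+4) (j+1+1)) := by
        unfold cd' cd ps; split_ifs <;> omega
      have := h1 (j+1+1) (by omega)
      have := hm (j+1+1) (by omega)
      nlinarith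
    have i1 := mul_nonneg (by linarith [h1 (0+1) (by omega)] : 0 ≤ m (0+1)) e1
    have i2 := mul_nonneg (by linarith [h1 (n+3) (by omega)] : 0 ≤ m (n+3)) e2
    rw [e0]
    simp only [Finset.sum_const, Finset.card_range, nsmul_eq_mul] at e3
    push_cast at e3
    nlinarith
  have hN := h1 (n+4) (by omega)
  have h0 := h1 0 (by omega)
  have a1 : ∑ j ∈ range (n+4), m (n+4) * m j * ((cd' (n+4+1) (n+4) j : ℤ) - cd (n+4+1) (n+4) j)
      = m (n+4) * ∑ j ∈ range (n+4), m j * ((cd' (n+5) (n+4) j : ℤ) - cd (n+5) (n+4) j) := by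
    rw [Finset.mul_sum]; exact Finset.sum_congr rfl fun _ _ => by ring
  have a2 : ∑ j ∈ range (n+4), m j * m (n+4) * ((cd' (n+4+1) j (n+4) : ℤ) - cd (n+4+1) j (n+4))
      = m (n+4) * ∑ j ∈ range (n+4), m j * ((cd' (n+5) (n+4) j : ℤ) - cd (n+5) (n+4) j) := by
    rw [Finset.mul_sum]
    refine Finset.sum_congr rfl fun j hj => ?_
    rw [Finset.mem_range] at hj
    have : ((cd' (n+4+1) j (n+4) : ℤ) - cd (n+4+1) j (n+4))
      = ((cd' (n+5) (n+4) j : ℤ) - cd (n+5) (n+4) j) := by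
      unfold cd' cd ps; split_ifs <;> omega
    rw [this]; ring
  have a3 : (cd' (n+4+1) (n+4) (n+4) : ℤ) - cd (n+4+1) (n+4) (n+4) = 0 := by
    simp [cd', cd]
  rw [a1, a2, a3]
  nlinarith

lemma cv'_in (n i k : ℕ) (hi : i < n+4) (hk : k < n+4) :
    cv' (n+4+1) i k = if i ≤ k then k - i else i - k - 1 := by
  unfold cv' cd' ps lo EW.hi; split_ifs <;> omega

lemma cv'_top (n k : ℕ) (hk : k < n+4) :
    cv' (n+4+1) (n+4) k = if k < n+2 then n+2-k else if k = n+2 then 1 else 0 := by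
  unfold cv' cd' ps lo EW.hi; split_ifs <;> omega

lemma cv'_last (n k : ℕ) (hk : k < n+5) :
    cv' (n+4+1) k (n+4) = if k < n+3 then n+2-k else if k = n+3 then 1 else 0 := by
  unfold cv' cd' ps lo EW.hi; split_ifs <;> omega

lemma cv_eq (n i k : ℕ) (hi : i < n+5) (hk : k < n+5) :
    cv (n+4+1) i k = if i ≤ k then min (k - i) (i + (n+4) - k) else min (i - k - 1) (n+5-i+k) := by
  unfold cv nx
  by_cases h : k = n+4
  · subst h
    unfold cd; split_ifs <;> omega
  · rw [if_neg (by omega)]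
    unfold cd; split_ifs <;> omega

lemma num2 (n : ℕ) (m : ℕ → ℤ) (h1 : ∀ i < n+5, 1 ≤ m i) (hm : ∀ i < n+5, m i ≤ m 0) :
    0 ≤ ∑ i ∈ range (n+5), ∑ k ∈ range (n+5), m i * ((cv' (n+5) i k : ℤ) - cv (n+5) i k) := by
  rw [show n + 5 = (n+4)+1 from rfl, dsum]
  have h0 := h1 0 (by omega)
  have nn : ∀ i ∈ range (n+4), ∀ k ∈ range (n+4),
      0 ≤ m i * ((cv' (n+4+1) i k : ℤ) - cv (n+4+1) i k) := by
    intro i hi k hk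
    rw [Finset.mem_range] at hi hk
    have := h1 i (by omega)
    have : (0:ℤ) ≤ (cv' (n+4+1) i k : ℤ) - cv (n+4+1) i k := by
      rw [cv_eq n _ _ (by omega) (by omega)]; first | rw [cv'_in n _ _ (by omega) (by omega)] | rw [cv'_top n _ (by omega)] | rw [cv'_last n _ (by omega)]
      (split_ifs <;> omega)
    positivity
  have b1 : m 0 * (n+2) ≤ ∑ i ∈ range (n+4), ∑ k ∈ range (n+4),
      m i * ((cv' (n+4+1) i k : ℤ) - cv (n+4+1) i k) := by
    refine le_trans ?_ (Finset.single_le_sum (f := fun i => ∑ k ∈ range (n+4),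
      m i * ((cv' (n+4+1) i k : ℤ) - cv (n+4+1) i k))
      (fun i hi => Finset.sum_nonneg (nn i hi)) (Finset.mem_range.2 (by omega : 0 < n+4)))
    refine le_trans ?_ (Finset.single_le_sum (f := fun k =>
      m 0 * ((cv' (n+4+1) 0 k : ℤ) - cv (n+4+1) 0 k))
      (nn 0 (Finset.mem_range.2 (by omega))) (Finset.mem_range.2 (by omega : n+3 < n+4)))
    have : (n:ℤ)+2 ≤ (cv' (n+4+1) 0 (n+3) : ℤ) - cv (n+4+1) 0 (n+3) := by
      rw [cv_eq n _ _ (by omega) (by omega)]; first | rw [cv'_in n _ _ (by omega) (by omega)] | rw [cv'_top n _ (by omega)] | rw [cv'_last n _ (by omega)]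
      (split_ifs <;> omega)
    exact mul_le_mul_of_nonneg_left this (by linarith)
  have b2 : m 0 * (n+2) - 2 * (n+2) * m 0 ≤ ∑ i ∈ range (n+4),
      m i * ((cv' (n+4+1) i (n+4) : ℤ) - cv (n+4+1) i (n+4)) := by
    rw [Finset.sum_range_succ, Finset.sum_range_succ']
    have e0 : (n:ℤ)+2 ≤ (cv' (n+4+1) 0 (n+4) : ℤ) - cv (n+4+1) 0 (n+4) := by
      rw [cv_eq n _ _ (by omega) (by omega)]; first | rw [cv'_in n _ _ (by omega) (by omega)] | rw [cv'_top n _ (by omega)] | rw [cv'_last n _ (by omega)]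
      (split_ifs <;> omega)
    have e1 : 0 ≤ (cv' (n+4+1) (n+3) (n+4) : ℤ) - cv (n+4+1) (n+3) (n+4) := by
      rw [cv_eq n _ _ (by omega) (by omega)]; first | rw [cv'_in n _ _ (by omega) (by omega)] | rw [cv'_top n _ (by omega)] | rw [cv'_last n _ (by omega)]
      (split_ifs <;> omega)
    have e3 : ∑ j ∈ range (n+2), (- 2 * m 0) ≤ ∑ i ∈ range (n+2),
        m (i+1) * ((cv' (n+4+1) (i+1) (n+4) : ℤ) - cv (n+4+1) (i+1) (n+4)) := by
      refine Finset.sum_le_sum fun j hj => ?_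
      rw [Finset.mem_range] at hj
      have : -2 ≤ ((cv' (n+4+1) (j+1) (n+4) : ℤ) - cv (n+4+1) (j+1) (n+4)) := by
        rw [cv_eq n _ _ (by omega) (by omega)]; first | rw [cv'_in n _ _ (by omega) (by omega)] | rw [cv'_top n _ (by omega)] | rw [cv'_last n _ (by omega)]
        (split_ifs <;> omega)
      have := h1 (j+1) (by omega)
      have := hm (j+1) (by omega)
      nlinarith
    have i1 := mul_nonneg (by linarith [h1 (n+3) (by omega)] : 0 ≤ m (n+3)) e1
    have i0 := mul_le_mul_of_nonneg_left e0 (by linarith : 0 ≤ m 0)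
    simp only [Finset.sum_const, Finset.card_range, nsmul_eq_mul] at e3
    push_cast at e3
    linarith
  have b3 : 0 ≤ ∑ k ∈ range (n+4),
      m (n+4) * ((cv' (n+4+1) (n+4) k : ℤ) - cv (n+4+1) (n+4) k) := by
    rw [← Finset.mul_sum]
    refine mul_nonneg (by linarith [h1 (n+4) (by omega)]) ?_
    rw [Finset.sum_range_succ, Finset.sum_range_succ, Finset.sum_range_succ']
    have e0 : (n:ℤ)+1 ≤ (cv' (n+4+1) (n+4) 0 : ℤ) - cv (n+4+1) (n+4) 0 := by
      rw [cv_eq n _ _ (by omega) (by omega)]; first | rw [cv'_in n _ _ (by omega) (by omega)] | rw [cv'_top n _ (by omega)] | rw [cv'_last n _ (by omega)]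
      (split_ifs <;> omega)
    have e1 : 0 ≤ (cv' (n+4+1) (n+4) (n+2) : ℤ) - cv (n+4+1) (n+4) (n+2) := by
      rw [cv_eq n _ _ (by omega) (by omega)]; first | rw [cv'_in n _ _ (by omega) (by omega)] | rw [cv'_top n _ (by omega)] | rw [cv'_last n _ (by omega)]
      (split_ifs <;> omega)
    have e2 : 0 ≤ (cv' (n+4+1) (n+4) (n+3) : ℤ) - cv (n+4+1) (n+4) (n+3) := by
      rw [cv_eq n _ _ (by omega) (by omega)]; first | rw [cv'_in n _ _ (by omega) (by omega)] | rw [cv'_top n _ (by omega)] | rw [cv'_last n _ (by omega)]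
      (split_ifs <;> omega)
    have e3 : ∑ j ∈ range (n+1), (- 1 : ℤ) ≤ ∑ i ∈ range (n+1),
        ((cv' (n+4+1) (n+4) (i+1) : ℤ) - cv (n+4+1) (n+4) (i+1)) := by
      refine Finset.sum_le_sum fun j hj => ?_
      rw [Finset.mem_range] at hj
      rw [cv_eq n _ _ (by omega) (by omega)]; first | rw [cv'_in n _ _ (by omega) (by omega)] | rw [cv'_top n _ (by omega)] | rw [cv'_last n _ (by omega)]
      (split_ifs <;> omega)
    simp only [Finset.sum_const, Finset.card_range, nsmul_eq_mul] at e3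
    push_cast at e3
    linarith
  have b4 : 0 ≤ m (n+4) * ((cv' (n+4+1) (n+4) (n+4) : ℤ) - cv (n+4+1) (n+4) (n+4)) := by
    refine mul_nonneg (by linarith [h1 (n+4) (by omega)]) ?_
    rw [cv_eq n _ _ (by omega) (by omega)]; first | rw [cv'_in n _ _ (by omega) (by omega)] | rw [cv'_top n _ (by omega)] | rw [cv'_last n _ (by omega)]
    (split_ifs <;> omega)
  linarith

lemma num3_row (n : ℕ) (f : ℕ → ℤ) (e0 : (n:ℤ)+1 ≤ f 0) (e1 : -1 ≤ f 1)
    (e2 : ∀ j < n, -2 ≤ f (j+2)) (e3 : -1 ≤ f (n+2)) (e4 : 0 ≤ f (n+3)) :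
    -(n+1 : ℤ) ≤ ∑ k ∈ range (n+4), f k := by
  rw [Finset.sum_range_succ, Finset.sum_range_succ, Finset.sum_range_succ', Finset.sum_range_succ']
  have e5 : ∑ j ∈ range n, (- 2 : ℤ) ≤ ∑ i ∈ range n, f (i+1+1) :=
    Finset.sum_le_sum fun j hj => e2 j (Finset.mem_range.1 hj)
  simp only [Finset.sum_const, Finset.card_range, nsmul_eq_mul] at e5
  simp only [zero_add]
  linarith

lemma num3 (n : ℕ) :
    0 ≤ ∑ i ∈ range (n+5), ∑ k ∈ range (n+5), ((ce' (n+5) i k : ℤ) - ce (n+5) i k) := by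
  rw [show n + 5 = (n+4)+1 from rfl, dsum]
  have hlast : ∀ k < n+4, (ce' (n+4+1) k (n+4) : ℤ) = if k < n+2 then (n:ℤ)+2-k else 1 := by
    intro k hk
    have hlo : lo (n+4+1) k = k := by unfold lo; split_ifs <;> omega
    have hhi : EW.hi (n+4+1) k = k+1 := by unfold EW.hi; split_ifs <;> omega
    unfold ce'
    rw [hlo, hhi, cv'_last n _ (by omega), cv'_last n _ (by omega)]
    split_ifs <;> omega
  have hlast2 : ∀ k < n+4, (ce' (n+4+1) (n+4) k : ℤ) = if k < n+2 then (n:ℤ)+2-k else 1 := by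
    intro k hk
    have hlo : lo (n+4+1) (n+4) = n+2 := by unfold lo; split_ifs <;> omega
    have hhi : EW.hi (n+4+1) (n+4) = n+4 := by unfold EW.hi; split_ifs <;> omega
    unfold ce'
    rw [hlo, hhi, cv'_in n _ _ (by omega) (by omega), cv'_top n _ (by omega)]
    split_ifs <;> omega
  have hG : ∀ i < n+5, ∀ k < n+5, ce (n+4+1) i k = cd (n+5) i k := by
    intro i hi k hk
    unfold ce nx
    show (if i = k then 0 else min (cv (n+4+1) i k) _ + 1) = _
    rw [cv_eq n _ _ (by omega) (by omega)]
    by_cases h : i = n+4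
    · rw [if_pos (by omega : i = n+4+1-1), cv_eq n _ _ (by omega) (by omega)]
      unfold cd; split_ifs <;> omega
    · rw [if_neg (by omega : ¬ i = n+4+1-1), cv_eq n _ _ (by omega) (by omega)]
      unfold cd; split_ifs <;> omega
  have hin : ∀ i < n+4, ∀ k < n+4, ce' (n+4+1) i k = (i-k)+(k-i) := by
    intro i hi k hk
    have hlo : lo (n+4+1) i = i := by unfold lo; split_ifs <;> omega
    have hhi : EW.hi (n+4+1) i = i+1 := by unfold EW.hi; split_ifs <;> omega
    unfold ce'
    rw [hlo, hhi, cv'_in n _ _ (by omega) (by omega)]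
    by_cases h : i + 1 = n+4
    · rw [h, cv'_top n _ (by omega)]
      split_ifs <;> omega
    · rw [cv'_in n _ _ (by omega) (by omega)]
      split_ifs <;> omega
  have b1 : 2 * ((n:ℤ)+1) ≤ ∑ i ∈ range (n+4), ∑ k ∈ range (n+4),
      ((ce' (n+4+1) i k : ℤ) - ce (n+4+1) i k) := by
    have : ∑ i ∈ range (n+4), ∑ k ∈ range (n+4), ((if i = 0 then (if k = n+3 then (n:ℤ)+1 else 0) else 0)
      + (if i = n+3 then (if k = 0 then (n:ℤ)+1 else 0) else 0)) = 2 * ((n:ℤ)+1) := by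
      simp only [Finset.sum_add_distrib]
      rw [Finset.sum_eq_single 0, Finset.sum_eq_single (n+3), Finset.sum_eq_single (n+3), Finset.sum_eq_single 0]
      all_goals first | (simp; done) | (simp +contextual; done) | (simp; ring)
    rw [← this]
    refine Finset.sum_le_sum fun i hi => Finset.sum_le_sum fun k hk => ?_
    rw [Finset.mem_range] at hi hk
    rw [hG i (by omega) k (by omega), hin i hi k hk]
    unfold cd
    split_ifs <;> omega
  have b2 : -(n+1 : ℤ) ≤ ∑ i ∈ range (n+4), ((ce' (n+4+1) i (n+4) : ℤ) - ce (n+4+1) i (n+4)) := by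
    apply num3_row
    all_goals try intro j hj
    all_goals rw [hG _ (by omega) _ (by omega), hlast _ (by omega)]; unfold cd; split_ifs <;> omega
  have b3 : -(n+1 : ℤ) ≤ ∑ i ∈ range (n+4), ((ce' (n+4+1) (n+4) i : ℤ) - ce (n+4+1) (n+4) i) := by
    apply num3_row
    all_goals try intro j hj
    all_goals rw [hG _ (by omega) _ (by omega), hlast2 _ (by omega)]; unfold cd; split_ifs <;> omega
  have b4 : (ce' (n+4+1) (n+4) (n+4) : ℤ) - ce (n+4+1) (n+4) (n+4) = 0 := by simp [ce', ce]
  linarith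

end EW

namespace EW

variable {V : Type*}

lemma eDist_comm (G : SimpleGraph V) (e f : Sym2 V) : eDist G e f = eDist G f e := by
  have : {n : ℕ | ∃ u ∈ e, ∃ w ∈ f, G.dist u w = n} = {n : ℕ | ∃ u ∈ f, ∃ w ∈ e, G.dist u w = n} := by
    ext n
    constructor
    · rintro ⟨u, hu, w, hw, h⟩
      exact ⟨w, hw, u, hu, by rw [SimpleGraph.dist_comm, h]⟩
    · rintro ⟨u, hu, w, hw, h⟩
      exact ⟨w, hw, u, hu, by rw [SimpleGraph.dist_comm, h]⟩
  unfold eDist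
  rw [this]
  simp only [eq_comm]

lemma eDist_le (G : SimpleGraph V) {e f : Sym2 V} {u w : V} (hu : u ∈ e) (hw : w ∈ f) :
    eDist G e f ≤ G.dist u w + 1 := by
  unfold eDist
  split_ifs
  · omega
  · have h : G.dist u w ∈ {n : ℕ | ∃ u ∈ e, ∃ w ∈ f, G.dist u w = n} := ⟨u, hu, w, hw, rfl⟩
    exact Nat.add_le_add_right (Nat.sInf_le h) 1

lemma eDist_self (G : SimpleGraph V) (e : Sym2 V) : eDist G e e = 0 := by simp [eDist]

lemma eDist_exists (G : SimpleGraph V) {e f : Sym2 V} (h : e ≠ f) :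
    ∃ u ∈ e, ∃ w ∈ f, eDist G e f = G.dist u w + 1 := by
  have hne : {n : ℕ | ∃ u ∈ e, ∃ w ∈ f, G.dist u w = n}.Nonempty :=
    ⟨_, e.out.1, Sym2.out_fst_mem e, f.out.1, Sym2.out_fst_mem f, rfl⟩
  obtain ⟨u, hu, w, hw, h'⟩ := Nat.sInf_mem hne
  refine ⟨u, hu, w, hw, ?_⟩
  rw [h']
  simp [eDist, h]

lemma lip {K : SimpleGraph V} (F : V → ℕ) (hF : ∀ y z, K.Adj y z → F z ≤ F y + 1)
    {x y : V} (h : K.Reachable x y) : F y ≤ F x + K.dist x y := by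
  obtain ⟨p, hp⟩ := h.exists_walk_length_eq_dist
  rw [← hp]
  clear hp h
  induction p with
  | nil => simp
  | cons hadj p ih =>
    have := hF _ _ hadj
    simp only [SimpleGraph.Walk.length_cons]
    omega

lemma dist_step {H : SimpleGraph V} {x y z : V} (h : H.Reachable x y) (ha : H.Adj y z) :
    H.dist x z ≤ H.dist x y + 1 := by
  obtain ⟨p, hp⟩ := h.exists_walk_length_eq_dist
  rw [← hp, ← SimpleGraph.Walk.length_concat p ha]
  exact SimpleGraph.dist_le _

lemma dist_lower (H K : SimpleGraph V) (l : ℕ) (v : ℕ → V) (c : ℕ → ℕ → ℕ)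
    (hK : ∀ x y, K.Reachable x y)
    (hsep : ∀ i < l, ∀ j < l, i ≠ j → ¬ H.Reachable (v i) (v j))
    (hcov : ∀ x, ∃ i < l, H.Reachable (v i) x)
    (hadj : ∀ y z, K.Adj y z → H.Adj y z ∨
      ∃ a < l, ∃ b < l, y = v a ∧ z = v b ∧ ∀ i < l, c i b ≤ c i a + 1)
    (hc0 : ∀ i, c i i = 0) {x y : V} {i j : ℕ} (hi : i < l) (hj : j < l)
    (hx : H.Reachable (v i) x) (hy : H.Reachable (v j) y) :
    (i = j → H.dist x y ≤ K.dist x y) ∧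
    (i ≠ j → H.dist x (v i) + c i j + H.dist (v j) y ≤ K.dist x y) := by
  choose p hpl hp using hcov
  have huniq : ∀ a < l, ∀ z, H.Reachable (v a) z → p z = a := by
    intro a ha z hz
    by_contra hne
    exact hsep _ (hpl z) _ ha hne ((hp z).trans hz.symm)
  let F : V → ℕ := fun z => if p z = i then H.dist x z
    else H.dist x (v i) + c i (p z) + H.dist (v (p z)) z
  have hFv : ∀ a < l, F (v a) = H.dist x (v i) + c i a := by
    intro a ha
    have hpa := huniq a ha (v a) (SimpleGraph.Reachable.refl _)
    simp only [F, hpa]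
    split_ifs with h
    · subst h; simp [hc0]
    · simp
  have hL : ∀ z w, K.Adj z w → F w ≤ F z + 1 := by
    intro z w hzw
    rcases hadj z w hzw with h | ⟨a, ha, b, hb, rfl, rfl, hab⟩
    · have hpe : p w = p z := huniq _ (hpl z) w ((hp z).trans h.reachable)
      simp only [F, hpe]
      split_ifs with h'
      · refine dist_step ?_ h
        have := hp z
        rw [h'] at this
        exact hx.symm.trans this
      · have := dist_step (hp z) h
        omega
    · rw [hFv a ha, hFv b hb]
      have := hab i hi
      omega
  have h := lip F hL (hK x y)
  have hx' := huniq i hi x hx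
  have hy' := huniq j hj y hy
  have h0 : F x = 0 := by simp [F, hx']
  rw [h0, zero_add] at h
  simp only [F, hy'] at h
  constructor
  · intro e
    simpa [e] using h
  · intro e
    rw [if_neg (fun h => e h.symm)] at h
    exact h

lemma path_le {G : SimpleGraph V} (hG : G.Connected) (v : ℕ → V) (l : ℕ)
    (h : ∀ k, k + 1 < l → G.Adj (v k) (v (k+1))) (t : ℕ) :
    ∀ i, i + t < l → G.dist (v i) (v (i+t)) ≤ t := by
  induction t with
  | zero => intro i _; simp
  | succ t ih =>
    intro i hi
    have h1 := ih i (by omega)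
    have h2 := dist_step (hG (v i) (v (i+t))) (h (i+t) (by omega))
    rw [← add_assoc]
    omega

lemma cyc_le {G : SimpleGraph V} (hG : G.Connected) (v : ℕ → V) (l : ℕ)
    (h : ∀ k, k + 1 < l → G.Adj (v k) (v (k+1))) (hlast : G.Adj (v 0) (v (l-1)))
    {i j : ℕ} (hi : i < l) (hj : j < l) : G.dist (v i) (v j) ≤ cd l i j := by
  wlog hij : i ≤ j generalizing i j
  · have := this hj hi (by omega)
    rw [SimpleGraph.dist_comm]
    refine this.trans (le_of_eq ?_)
    unfold cd; omega
  have h1 := path_le hG v l h (j - i) i (by omega)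
  rw [Nat.add_sub_cancel' hij] at h1
  have h2 := path_le hG v l h i 0 (by omega)
  rw [zero_add] at h2
  have h3 := path_le hG v l h (l - 1 - j) j (by omega)
  rw [show j + (l - 1 - j) = l - 1 by omega] at h3
  have h4 : G.dist (v i) (v j) ≤ G.dist (v i) (v 0) + G.dist (v 0) (v j) := hG.dist_triangle
  have h5 : G.dist (v 0) (v j) ≤ G.dist (v 0) (v (l-1)) + G.dist (v (l-1)) (v j) := hG.dist_triangle
  have h6 : G.dist (v 0) (v (l-1)) = 1 := SimpleGraph.dist_eq_one_iff_adj.2 hlast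
  rw [SimpleGraph.dist_comm] at h2 h3
  unfold cd; omega

lemma esum [Fintype V] (H K : SimpleGraph V) (l : ℕ) (v : ℕ → V) (a b : ℕ → ℕ)
    (hinj : ∀ i < l, ∀ j < l, v i = v j → i = j)
    (hsep : ∀ i < l, ∀ j < l, i ≠ j → ¬ H.Reachable (v i) (v j))
    (hcov : ∀ x, ∃ i < l, H.Reachable (v i) x)
    (ha : ∀ k < l, a k < l) (hb : ∀ k < l, b k < l) (hab : ∀ k < l, a k ≠ b k)
    (hab' : ∀ k < l, ∀ q < l, (a k = a q ∧ b k = b q) ∨ (a k = b q ∧ b k = a q) → k = q)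
    (hadj : ∀ y z, K.Adj y z ↔ H.Adj y z ∨ ∃ k < l, s(y, z) = s(v (a k), v (b k)))
    (φ : Sym2 V → ℤ) :
    ∑ e ∈ K.edgeFinset, φ e =
      ∑ i ∈ range l, ∑ f ∈ H.edgeFinset.filter (fun f => ∀ x ∈ f, H.Reachable (v i) x), φ f
      + ∑ k ∈ range l, φ s(v (a k), v (b k)) := by
  have hinjOn : ∀ k < l, ∀ q < l, s(v (a k), v (b k)) = s(v (a q), v (b q)) → k = q := by
    intro k hk q hq h
    apply hab' k hk q hq
    rw [Sym2.eq_iff] at h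
    rcases h with h | h
    · exact Or.inl ⟨hinj _ (ha k hk) _ (ha q hq) h.1, hinj _ (hb k hk) _ (hb q hq) h.2⟩
    · exact Or.inr ⟨hinj _ (ha k hk) _ (hb q hq) h.1, hinj _ (hb k hk) _ (ha q hq) h.2⟩
  have hE : K.edgeFinset = H.edgeFinset ∪ (range l).image (fun k => s(v (a k), v (b k))) := by
    ext e
    induction e with
    | _ y z =>
      simp only [SimpleGraph.mem_edgeFinset, Finset.mem_union, Finset.mem_image, Finset.mem_range,
        SimpleGraph.mem_edgeSet, hadj]
      simp only [eq_comm]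
  have hd : Disjoint H.edgeFinset ((range l).image (fun k => s(v (a k), v (b k)))) := by
    rw [Finset.disjoint_left]
    intro e he he'
    rw [Finset.mem_image] at he'
    obtain ⟨k, hk, rfl⟩ := he'
    rw [Finset.mem_range] at hk
    rw [SimpleGraph.mem_edgeFinset, SimpleGraph.mem_edgeSet] at he
    exact hsep _ (ha k hk) _ (hb k hk) (hab k hk) he.reachable
  have hH : H.edgeFinset = (range l).biUnion
      (fun i => H.edgeFinset.filter (fun f => ∀ x ∈ f, H.Reachable (v i) x)) := by
    ext e
    simp only [Finset.mem_biUnion, Finset.mem_filter, Finset.mem_range]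
    constructor
    · intro he
      induction e with
      | _ y z =>
        obtain ⟨i, hi, h⟩ := hcov y
        refine ⟨i, hi, he, ?_⟩
        rw [SimpleGraph.mem_edgeFinset, SimpleGraph.mem_edgeSet] at he
        intro x hx
        rcases Sym2.mem_iff.1 hx with rfl | rfl
        · exact h
        · exact h.trans he.reachable
    · rintro ⟨i, _, he, _⟩
      exact he
  rw [hE, Finset.sum_union hd, Finset.sum_image]
  · congr 1
    conv_lhs => rw [hH]
    rw [Finset.sum_biUnion]
    intro i hi j hj hij
    rw [Function.onFun, Finset.disjoint_left]
    intro e he he'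
    rw [Finset.mem_filter] at he he'
    have hi' := Finset.mem_range.1 (Finset.mem_coe.1 hi)
    have hj' := Finset.mem_range.1 (Finset.mem_coe.1 hj)
    have hm := Sym2.out_fst_mem e
    exact hsep i hi' j hj' hij ((he.2 _ hm).trans (he'.2 _ hm).symm)
  · intro k hk q hq h
    exact hinjOn k (Finset.mem_range.1 (Finset.mem_coe.1 hk)) q
      (Finset.mem_range.1 (Finset.mem_coe.1 hq)) h

end EW

theorem stmt7 {V : Type*} [Fintype V] (l : ℕ) (hl : 5 ≤ l)
    (G : SimpleGraph V) (hconn : G.Connected)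
    (v : ℕ → V)
    (hinj : ∀ i < l, ∀ j < l, v i = v j → i = j)
    (hcyc : ∀ i < l, G.Adj (v i) (v ((i + 1) % l)))
    (H : SimpleGraph V)
    (hH : H = G.deleteEdges {e | ∃ i < l, e = s(v i, v ((i + 1) % l))})
    (hsep : ∀ i < l, ∀ j < l, i ≠ j → ¬ H.Reachable (v i) (v j))
    (m : ℕ → ℕ)
    (hm : ∀ i < l,
      m i = (H.edgeFinset.filter (fun f => ∀ x ∈ f, H.Reachable (v i) x)).card)
    (hm1 : ∀ i < l, 1 ≤ m i) (hmax : ∀ i < l, m i ≤ m 0)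
    (G' : SimpleGraph V)
    (hG' : G' = SimpleGraph.fromRel (fun a b =>
        (G.Adj a b ∧ s(a, b) ≠ s(v 0, v (l - 1))) ∨ (a = v (l - 3) ∧ b = v (l - 1)))) :
    edgeWiener G < edgeWiener G' := by
  obtain ⟨n, rfl⟩ : ∃ n, l = n + 5 := ⟨l - 5, by omega⟩
  have hnx : ∀ k < n+5, (k+1) % (n+5) = EW.nx (n+5) k := by
    intro k hk
    unfold EW.nx
    split_ifs with h
    · rw [h]; simp
    · exact Nat.mod_eq_of_lt (by omega)
  have nxl : ∀ k < n+5, EW.nx (n+5) k < n+5 := by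
    intro k hk; unfold EW.nx; split_ifs <;> omega
  have lol : ∀ k < n+5, EW.lo (n+5) k < n+5 := by
    intro k hk; unfold EW.lo; split_ifs <;> omega
  have hil : ∀ k < n+5, EW.hi (n+5) k < n+5 := by
    intro k hk; unfold EW.hi; split_ifs <;> omega
  have nxne : ∀ k < n+5, k ≠ EW.nx (n+5) k := by
    intro k hk; unfold EW.nx; split_ifs <;> omega
  have lone : ∀ k < n+5, EW.lo (n+5) k ≠ EW.hi (n+5) k := by
    intro k hk; unfold EW.lo EW.hi; split_ifs <;> omega
  have nxinj : ∀ k < n+5, ∀ q < n+5, (k = q ∧ EW.nx (n+5) k = EW.nx (n+5) q) ∨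
      (k = EW.nx (n+5) q ∧ EW.nx (n+5) k = q) → k = q := by
    intro k hk q hq; unfold EW.nx; split_ifs <;> omega
  have loinj : ∀ k < n+5, ∀ q < n+5,
      (EW.lo (n+5) k = EW.lo (n+5) q ∧ EW.hi (n+5) k = EW.hi (n+5) q) ∨
      (EW.lo (n+5) k = EW.hi (n+5) q ∧ EW.hi (n+5) k = EW.lo (n+5) q) → k = q := by
    intro k hk q hq; unfold EW.lo EW.hi; split_ifs <;> omega
  have hset : {e : Sym2 V | ∃ i < n+5, e = s(v i, v ((i + 1) % (n+5)))} =
      {e | ∃ i < n+5, e = s(v i, v (EW.nx (n+5) i))} := by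
    ext e
    constructor
    · rintro ⟨i, hi, h⟩; exact ⟨i, hi, by rw [← hnx i hi]; exact h⟩
    · rintro ⟨i, hi, h⟩; exact ⟨i, hi, by rw [hnx i hi]; exact h⟩
  rw [hset] at hH
  have hcyc' : ∀ i < n+5, G.Adj (v i) (v (EW.nx (n+5) i)) := by
    intro i hi; rw [← hnx i hi]; exact hcyc i hi
  have hHadj : ∀ y z, H.Adj y z ↔ G.Adj y z ∧ ¬ ∃ k < n+5, s(y, z) = s(v k, v (EW.nx (n+5) k)) := by
    intro y z; rw [hH, SimpleGraph.deleteEdges_adj]; rfl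
  have hGadj : ∀ y z, G.Adj y z ↔ H.Adj y z ∨ ∃ k < n+5, s(y, z) = s(v k, v (EW.nx (n+5) k)) := by
    intro y z
    rw [hHadj]
    constructor
    · intro h; by_cases h' : ∃ k < n+5, s(y, z) = s(v k, v (EW.nx (n+5) k))
      · exact Or.inr h'
      · exact Or.inl ⟨h, h'⟩
    · rintro (h | ⟨k, hk, h⟩)
      · exact h.1
      · rw [← SimpleGraph.mem_edgeSet, h]; exact hcyc' k hk
  have hHG : H ≤ G := fun y z h => ((hHadj y z).1 h).1
  have hcov : ∀ x, ∃ i < n+5, H.Reachable (v i) x := by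
    intro x
    obtain ⟨p⟩ := hconn x (v 0)
    suffices ∀ y (p : G.Walk x y), (∃ i < n+5, H.Reachable (v i) y) → ∃ i < n+5, H.Reachable (v i) x from
      this _ p ⟨0, by omega, SimpleGraph.Reachable.refl _⟩
    intro y p hy
    clear * - p hy hGadj nxl
    induction p with
    | nil => exact hy
    | @cons a b c h p ih =>
      obtain ⟨i, hi, hb⟩ := ih hy
      rcases (hGadj a b).1 h with h | ⟨k, hk, h⟩
      · exact ⟨i, hi, hb.trans h.symm.reachable⟩
      · have : a ∈ s(v k, v (EW.nx (n+5) k)) := by rw [← h]; simp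
        rcases Sym2.mem_iff.1 this with rfl | rfl
        · exact ⟨k, hk, SimpleGraph.Reachable.refl _⟩
        · exact ⟨_, nxl k hk, SimpleGraph.Reachable.refl _⟩
  have hG'adj : ∀ y z, G'.Adj y z ↔
      H.Adj y z ∨ ∃ k < n+5, s(y, z) = s(v (EW.lo (n+5) k), v (EW.hi (n+5) k)) := by
    have hkey : ∀ y z, (G.Adj y z ∧ s(y, z) ≠ s(v 0, v (n+5-1))) ↔
        H.Adj y z ∨ ∃ k < n+4, s(y, z) = s(v k, v (k+1)) := by
      intro y z
      constructor
      · rintro ⟨h, hne⟩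
        rcases (hGadj y z).1 h with h | ⟨k, hk, h⟩
        · exact Or.inl h
        · by_cases hk' : k = n+4
          · subst hk'
            exfalso; apply hne
            rw [h, Sym2.eq_swap]
            simp [EW.nx]
          · refine Or.inr ⟨k, by omega, ?_⟩
            rw [h]
            unfold EW.nx; rw [if_neg (by omega)]
      · have hlast : s(v 0, v (n+5-1)) = s(v (n+4), v (EW.nx (n+5) (n+4))) := by
          rw [Sym2.eq_swap]; simp [EW.nx]
        rintro (h | ⟨k, hk, h⟩)
        · refine ⟨((hHadj y z).1 h).1, fun h' => ((hHadj y z).1 h).2 ⟨n+4, by omega, ?_⟩⟩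
          rw [h', hlast]
        · have hk2 : s(y, z) = s(v k, v (EW.nx (n+5) k)) := by
            rw [h]; unfold EW.nx; rw [if_neg (by omega)]
          refine ⟨(hGadj y z).2 (Or.inr ⟨k, by omega, hk2⟩), ?_⟩
          rw [h]
          intro h'
          rw [Sym2.eq_iff] at h'
          rcases h' with ⟨h1, h2⟩ | ⟨h1, h2⟩
          · have := hinj _ (by omega) _ (by omega) h1
            have := hinj _ (by omega) _ (by omega) h2
            omega
          · have := hinj _ (by omega) _ (by omega) h1
            have := hinj _ (by omega) _ (by omega) h2
            omega
    have hne : v (n+5-3) ≠ v (n+5-1) := by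
      intro h
      have := hinj _ (by omega) _ (by omega) h
      omega
    have hsplit : ∀ y z, (∃ k < n+5, s(y, z) = s(v (EW.lo (n+5) k), v (EW.hi (n+5) k))) ↔
        (∃ k < n+4, s(y, z) = s(v k, v (k+1))) ∨ s(y, z) = s(v (n+5-3), v (n+5-1)) := by
      intro y z
      constructor
      · rintro ⟨k, hk, h⟩
        unfold EW.lo EW.hi at h
        by_cases hk' : k = n+5-1
        · rw [if_pos hk', if_pos hk'] at h; exact Or.inr h
        · rw [if_neg hk', if_neg hk'] at h; exact Or.inl ⟨k, by omega, h⟩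
      · rintro (⟨k, hk, h⟩ | h)
        · refine ⟨k, by omega, ?_⟩
          unfold EW.lo EW.hi
          rw [if_neg (by omega), if_neg (by omega)]; exact h
        · refine ⟨n+5-1, by omega, ?_⟩
          unfold EW.lo EW.hi
          rw [if_pos rfl, if_pos rfl]; exact h
    intro y z
    rw [hsplit, ← or_assoc, ← hkey, hG', SimpleGraph.fromRel_adj]
    constructor
    · rintro ⟨_, (h | ⟨rfl, rfl⟩) | (h | ⟨rfl, rfl⟩)⟩
      · exact Or.inl h
      · exact Or.inr rfl
      · exact Or.inl ⟨h.1.symm, by rw [Sym2.eq_swap]; exact h.2⟩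
      · exact Or.inr Sym2.eq_swap
    · rintro (h | h)
      · exact ⟨h.1.ne, Or.inl (Or.inl h)⟩
      · rw [Sym2.eq_iff] at h
        rcases h with ⟨rfl, rfl⟩ | ⟨rfl, rfl⟩
        · exact ⟨hne, Or.inl (Or.inr ⟨rfl, rfl⟩)⟩
        · exact ⟨hne.symm, Or.inr (Or.inr ⟨rfl, rfl⟩)⟩
  have hHG' : H ≤ G' := fun y z h => (hG'adj y z).2 (Or.inl h)
  have hG'r0 : ∀ k < n+5, G'.Reachable (v 0) (v k) := by
    intro k
    induction k with
    | zero => intro _; exact SimpleGraph.Reachable.refl _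
    | succ k ih =>
      intro hk
      by_cases hk' : k + 1 = n+4
      · refine (ih (by omega)).trans (SimpleGraph.Adj.reachable ?_)
        refine (hG'adj _ _).2 (Or.inr ⟨k, by omega, ?_⟩)
        unfold EW.lo EW.hi
        rw [if_neg (by omega), if_neg (by omega)]
      · refine (ih (by omega)).trans (SimpleGraph.Adj.reachable ?_)
        refine (hG'adj _ _).2 (Or.inr ⟨k, by omega, ?_⟩)
        unfold EW.lo EW.hi
        rw [if_neg (by omega), if_neg (by omega)]
  have hG'r : ∀ x y, G'.Reachable x y := by
    intro x y
    obtain ⟨i, hi, hx⟩ := hcov x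
    obtain ⟨j, hj, hy⟩ := hcov y
    exact (hx.mono hHG').symm.trans ((hG'r0 i hi).symm.trans ((hG'r0 j hj).trans (hy.mono hHG')))
  have hc0 : ∀ i, EW.cd' (n+5) i i = 0 := by intro i; simp [EW.cd']
  have hstep : ∀ k < n+5, ∀ i < n+5,
      EW.cd' (n+5) i (EW.hi (n+5) k) ≤ EW.cd' (n+5) i (EW.lo (n+5) k) + 1 ∧
      EW.cd' (n+5) i (EW.lo (n+5) k) ≤ EW.cd' (n+5) i (EW.hi (n+5) k) + 1 := by
    intro k hk i hi
    by_cases hk' : k = n+5-1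
    · unfold EW.lo EW.hi
      rw [if_pos hk', if_pos hk']
      unfold EW.cd' EW.ps; split_ifs <;> omega
    · unfold EW.lo EW.hi
      rw [if_neg hk', if_neg hk']
      unfold EW.cd' EW.ps; split_ifs <;> omega
  have hG'adj2 : ∀ y z, G'.Adj y z → H.Adj y z ∨ ∃ a < n+5, ∃ b < n+5, y = v a ∧ z = v b ∧
      ∀ i < n+5, EW.cd' (n+5) i b ≤ EW.cd' (n+5) i a + 1 := by
    intro y z h
    rcases (hG'adj y z).1 h with h | ⟨k, hk, h⟩
    · exact Or.inl h
    · right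
      rw [Sym2.eq_iff] at h
      rcases h with h | h
      · exact ⟨_, lol k hk, _, hil k hk, h.1, h.2, fun i hi => (hstep k hk i hi).1⟩
      · exact ⟨_, hil k hk, _, lol k hk, h.1, h.2, fun i hi => (hstep k hk i hi).2⟩
  have lower := fun {x y : V} {i j : ℕ} (hi : i < n+5) (hj : j < n+5)
    (hx : H.Reachable (v i) x) (hy : H.Reachable (v j) y) =>
    EW.dist_lower H G' (n+5) v (EW.cd' (n+5)) hG'r hsep hcov hG'adj2 hc0 hi hj hx hy
  have upc : ∀ i < n+5, ∀ j < n+5, G.dist (v i) (v j) ≤ EW.cd (n+5) i j := by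
    intro i hi j hj
    refine EW.cyc_le hconn v (n+5) ?_ ?_ hi hj
    · intro k hk
      have := hcyc' k (by omega)
      unfold EW.nx at this
      rwa [if_neg (by omega)] at this
    · have := hcyc' (n+4) (by omega)
      simp [EW.nx] at this
      exact this.symm
  have upper : ∀ x y i j, i < n+5 → j < n+5 → H.Reachable (v i) x → H.Reachable (v j) y →
      G.dist x y ≤ H.dist x (v i) + EW.cd (n+5) i j + H.dist (v j) y := by
    intro x y i j hi hj hx hy
    have h1 : G.dist x y ≤ G.dist x (v i) + G.dist (v i) y := hconn.dist_triangle
    have h2 : G.dist (v i) y ≤ G.dist (v i) (v j) + G.dist (v j) y := hconn.dist_triangle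
    have h3 := hx.symm.dist_anti hHG
    have h4 := hy.dist_anti hHG
    have h5 := upc i hi j hj
    omega
  -- lower bound towards cycle vertices
  have lowv : ∀ x i a, i < n+5 → a < n+5 → H.Reachable (v i) x →
      H.dist x (v i) + EW.cd' (n+5) i a ≤ G'.dist x (v a) := by
    intro x i a hi ha hx
    have h := lower hi ha hx (SimpleGraph.Reachable.refl (v a))
    by_cases hia : i = a
    · subst hia
      rw [hc0]; simpa using h.1 rfl
    · simpa using h.2 hia
  have upv : ∀ x i a, i < n+5 → a < n+5 → H.Reachable (v i) x →
      G.dist x (v a) ≤ H.dist x (v i) + EW.cd (n+5) i a := by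
    intro x i a hi ha hx
    simpa using upper x (v a) i a hi ha hx (SimpleGraph.Reachable.refl (v a))
  let A : ℕ → Finset (Sym2 V) := fun i => H.edgeFinset.filter (fun f => ∀ x ∈ f, H.Reachable (v i) x)
  let E : ℕ → Sym2 V := fun k => s(v k, v (EW.nx (n+5) k))
  let E' : ℕ → Sym2 V := fun k => s(v (EW.lo (n+5) k), v (EW.hi (n+5) k))
  have hA : ∀ i, ∀ f ∈ A i, f ∈ H.edgeFinset ∧ ∀ x ∈ f, H.Reachable (v i) x := by
    intro i f hf; exact Finset.mem_filter.1 hf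
  have B1 : ∀ i < n+5, ∀ j < n+5, ∀ f ∈ A i, ∀ g ∈ A j,
      ((EW.cd' (n+5) i j : ℤ) - EW.cd (n+5) i j) ≤ (eDist G' f g : ℤ) - eDist G f g := by
    intro i hi j hj f hf g hg
    by_cases hij : i = j
    · subst hij
      have z1 := hc0 i
      have z2 : EW.cd (n+5) i i = 0 := by simp [EW.cd]
      by_cases hfg : f = g
      · subst hfg; simp only [EW.eDist_self]; omega
      · obtain ⟨u, hu, w, hw, h⟩ := EW.eDist_exists G' hfg
        have h1 := EW.eDist_le G hu hw
        have ru := (hA i f hf).2 u hu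
        have rw' := (hA i g hg).2 w hw
        have h2 := (lower hi hi ru rw').1 rfl
        have h3 := (ru.symm.trans rw').dist_anti hHG
        omega
    · have hfg : f ≠ g := by
        rintro rfl
        have hm := Sym2.out_fst_mem f
        exact hsep i hi j hj hij (((hA i f hf).2 _ hm).trans ((hA j f hg).2 _ hm).symm)
      obtain ⟨u, hu, w, hw, h⟩ := EW.eDist_exists G' hfg
      have h1 := EW.eDist_le G hu hw
      have ru := (hA i f hf).2 u hu
      have rw' := (hA j g hg).2 w hw
      have h2 := (lower hi hj ru rw').2 hij
      have h3 := upper u w i j hi hj ru rw'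
      omega
  have B2 : ∀ i < n+5, ∀ k < n+5, ∀ f ∈ A i,
      ((EW.cv' (n+5) i k : ℤ) - EW.cv (n+5) i k) ≤ (eDist G' f (E' k) : ℤ) - eDist G f (E k) := by
    intro i hi k hk f hf
    have hfg : f ≠ E' k := by
      rintro rfl
      have h := (hA i _ hf).1
      rw [SimpleGraph.mem_edgeFinset, SimpleGraph.mem_edgeSet] at h
      exact hsep _ (lol k hk) _ (hil k hk) (lone k hk) h.reachable
    obtain ⟨u, hu, w, hw, h⟩ := EW.eDist_exists G' hfg
    have ru := (hA i f hf).2 u hu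
    have h1 := EW.eDist_le G (f := E k) hu (Sym2.mem_mk_left _ _)
    have h2 := EW.eDist_le G (f := E k) hu (Sym2.mem_mk_right _ _)
    have h3 := upv u i k hi hk ru
    have h4 := upv u i _ hi (nxl k hk) ru
    have h5 : H.dist u (v i) + EW.cv' (n+5) i k ≤ G'.dist u w := by
      unfold EW.cv'
      rcases Sym2.mem_iff.1 hw with rfl | rfl
      · have := lowv u i _ hi (lol k hk) ru
        omega
      · have := lowv u i _ hi (hil k hk) ru
        omega
    have h6 : eDist G f (E k) ≤ H.dist u (v i) + EW.cv (n+5) i k + 1 := by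
      unfold EW.cv
      omega
    omega
  have B3 : ∀ k < n+5, ∀ q < n+5,
      ((EW.ce' (n+5) k q : ℤ) - EW.ce (n+5) k q) ≤ (eDist G' (E' k) (E' q) : ℤ) - eDist G (E k) (E q) := by
    intro k hk q hq
    by_cases hkq : k = q
    · subst hkq; simp [EW.ce, EW.ce', EW.eDist_self]
    have hne : E' k ≠ E' q := by
      intro h
      apply hkq
      apply loinj k hk q hq
      simp only [E'] at h
      rw [Sym2.eq_iff] at h
      rcases h with h | h
      · exact Or.inl ⟨hinj _ (lol k hk) _ (lol q hq) h.1, hinj _ (hil k hk) _ (hil q hq) h.2⟩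
      · exact Or.inr ⟨hinj _ (lol k hk) _ (hil q hq) h.1, hinj _ (hil k hk) _ (lol q hq) h.2⟩
    obtain ⟨u, hu, w, hw, h⟩ := EW.eDist_exists G' hne
    have up1 : eDist G (E k) (E q) ≤ EW.ce (n+5) k q := by
      have h1 := EW.eDist_le G (e := E k) (f := E q) (Sym2.mem_mk_left _ _) (Sym2.mem_mk_left _ _)
      have h2 := EW.eDist_le G (e := E k) (f := E q) (Sym2.mem_mk_left _ _) (Sym2.mem_mk_right _ _)
      have h3 := EW.eDist_le G (e := E k) (f := E q) (Sym2.mem_mk_right _ _) (Sym2.mem_mk_left _ _)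
      have h4 := EW.eDist_le G (e := E k) (f := E q) (Sym2.mem_mk_right _ _) (Sym2.mem_mk_right _ _)
      have g1 := upc k hk q hq
      have g2 := upc k hk _ (nxl q hq)
      have g3 := upc _ (nxl k hk) q hq
      have g4 := upc _ (nxl k hk) _ (nxl q hq)
      unfold EW.ce EW.cv
      rw [if_neg hkq]
      omega
    have lo1 : EW.ce' (n+5) k q ≤ G'.dist u w + 1 := by
      have key : ∀ a < n+5, ∀ b < n+5, EW.cd' (n+5) a b ≤ G'.dist (v a) (v b) := by
        intro a ha b hb
        simpa using lowv (v a) a b ha hb (SimpleGraph.Reachable.refl _)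
      unfold EW.ce' EW.cv'
      rw [if_neg hkq]
      rcases Sym2.mem_iff.1 hu with rfl | rfl <;> rcases Sym2.mem_iff.1 hw with rfl | rfl
      · have := key _ (lol k hk) _ (lol q hq); omega
      · have := key _ (lol k hk) _ (hil q hq); omega
      · have := key _ (hil k hk) _ (lol q hq); omega
      · have := key _ (hil k hk) _ (hil q hq); omega
    omega
  have sG : ∀ φ : Sym2 V → ℤ, ∑ e ∈ G.edgeFinset, φ e =
      ∑ i ∈ range (n+5), ∑ f ∈ A i, φ f + ∑ k ∈ range (n+5), φ (E k) := fun φ =>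
    EW.esum H G (n+5) v (fun k => k) (EW.nx (n+5)) hinj hsep hcov (fun k hk => hk) nxl nxne nxinj hGadj φ
  have sG' : ∀ φ : Sym2 V → ℤ, ∑ e ∈ G'.edgeFinset, φ e =
      ∑ i ∈ range (n+5), ∑ f ∈ A i, φ f + ∑ k ∈ range (n+5), φ (E' k) := fun φ =>
    EW.esum H G' (n+5) v (EW.lo (n+5)) (EW.hi (n+5)) hinj hsep hcov lol hil lone loinj hG'adj φ
  have hcard : ∀ i < n+5, (m i : ℤ) = ((A i).card : ℤ) := by
    intro i hi; exact_mod_cast hm i hi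
  have N1 := EW.num1 n (fun i => (m i : ℤ)) (fun i hi => by exact_mod_cast hm1 i hi)
    (fun i hi => by exact_mod_cast hmax i hi)
  have N2 := EW.num2 n (fun i => (m i : ℤ)) (fun i hi => by exact_mod_cast hm1 i hi)
    (fun i hi => by exact_mod_cast hmax i hi)
  have N3 := EW.num3 n
  have C1 : ∑ i ∈ range (n+5), ∑ j ∈ range (n+5),
        (m i : ℤ) * m j * ((EW.cd' (n+5) i j : ℤ) - EW.cd (n+5) i j) ≤
      ∑ i ∈ range (n+5), ∑ f ∈ A i, ∑ j ∈ range (n+5), ∑ g ∈ A j,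
        ((eDist G' f g : ℤ) - eDist G f g) := by
    refine Finset.sum_le_sum fun i hi => ?_
    rw [Finset.sum_comm]
    refine Finset.sum_le_sum fun j hj => ?_
    have hi' := Finset.mem_range.1 hi
    have hj' := Finset.mem_range.1 hj
    rw [hcard i hi', hcard j hj']
    calc _ = ∑ f ∈ A i, ∑ g ∈ A j, ((EW.cd' (n+5) i j : ℤ) - EW.cd (n+5) i j) := by
          simp only [Finset.sum_const, nsmul_eq_mul]; ring
      _ ≤ _ := Finset.sum_le_sum fun f hf => Finset.sum_le_sum fun g hg => B1 i hi' j hj' f hf g hg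
  have C2 : ∑ i ∈ range (n+5), ∑ k ∈ range (n+5),
        (m i : ℤ) * ((EW.cv' (n+5) i k : ℤ) - EW.cv (n+5) i k) ≤
      ∑ i ∈ range (n+5), ∑ f ∈ A i, ∑ k ∈ range (n+5),
        ((eDist G' f (E' k) : ℤ) - eDist G f (E k)) := by
    refine Finset.sum_le_sum fun i hi => ?_
    rw [Finset.sum_comm]
    refine Finset.sum_le_sum fun k hk => ?_
    have hi' := Finset.mem_range.1 hi
    have hk' := Finset.mem_range.1 hk
    rw [hcard i hi']
    calc _ = ∑ f ∈ A i, ((EW.cv' (n+5) i k : ℤ) - EW.cv (n+5) i k) := by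
          simp only [Finset.sum_const, nsmul_eq_mul]
      _ ≤ _ := Finset.sum_le_sum fun f hf => B2 i hi' k hk' f hf
  have C3 : ∑ k ∈ range (n+5), ∑ q ∈ range (n+5), ((EW.ce' (n+5) k q : ℤ) - EW.ce (n+5) k q) ≤
      ∑ k ∈ range (n+5), ∑ q ∈ range (n+5), ((eDist G' (E' k) (E' q) : ℤ) - eDist G (E k) (E q)) :=
    Finset.sum_le_sum fun k hk => Finset.sum_le_sum fun q hq =>
      B3 k (Finset.mem_range.1 hk) q (Finset.mem_range.1 hq)
  have C4 : ∑ k ∈ range (n+5), ∑ i ∈ range (n+5), ∑ f ∈ A i,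
        ((eDist G' (E' k) f : ℤ) - eDist G (E k) f) =
      ∑ i ∈ range (n+5), ∑ f ∈ A i, ∑ k ∈ range (n+5),
        ((eDist G' f (E' k) : ℤ) - eDist G f (E k)) := by
    rw [Finset.sum_comm]
    refine Finset.sum_congr rfl fun i _ => ?_
    rw [Finset.sum_comm]
    refine Finset.sum_congr rfl fun f _ => Finset.sum_congr rfl fun k _ => ?_
    rw [EW.eDist_comm G', EW.eDist_comm G]
  have tot : (2 : ℤ) ≤ (∑ e ∈ G'.edgeFinset, ∑ f ∈ G'.edgeFinset, (eDist G' e f : ℤ)) -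
      ∑ e ∈ G.edgeFinset, ∑ f ∈ G.edgeFinset, (eDist G e f : ℤ) := by
    simp only [sG, sG', Finset.sum_add_distrib]
    simp only [Finset.sum_sub_distrib] at C1 C2 C3 C4
    simp only [Finset.sum_sub_distrib] at N1 N2 N3
    linarith
  have tot' : (∑ e ∈ G.edgeFinset, ∑ f ∈ G.edgeFinset, eDist G e f) + 2 ≤
      ∑ e ∈ G'.edgeFinset, ∑ f ∈ G'.edgeFinset, eDist G' e f := by
    zify
    linarith
  unfold edgeWiener
  omega
end

section
/- Let G1 be a connected simple graph with u1 ∈ V(G1), |V(G1)| ≥ 2 and m1 = |E(G1)| ≥ 1; let G2 be a connected simple graph that is not a path, with m2 = |E(G2)|, and let u and v be the two end-vertices of a longest path of G2 satisfying D_v(G2) ≥ D_u(G2), where D_x(G2) = Σ_{f ∈ E(G2)} d_{G2}(x,f); let P_s = p1p2⋯p_s be a path with s ≥ 2 vertices, all three graphs pairwise disjoint. Let G be obtained by identifying u1 with u and identifying p1 with v (so the path hangs at v and G1 hangs at u), and let G' be obtained by identifying u1 with p1 and identifying p_s with v (so the path is inserted between G1 and the vertex v of G2). Then W_e(G) < W_e(G').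 -/
open SimpleGraph Finset
open scoped Classical

/-- The vertex of `V1 ⊕ {y : V2 // y ≠ u2}` corresponding to `x : V2` after identifying
`u2` with `u1`. -/
noncomputable def glueVert {V1 V2 : Type*} (u1 : V1) (u2 : V2) (x : V2) :
    V1 ⊕ {y : V2 // y ≠ u2} :=
  if h : x = u2 then Sum.inl u1 else Sum.inr ⟨x, h⟩

/-- The graph obtained from disjoint graphs `G1`, `G2` by identifying `u1 ∈ V(G1)` with
`u2 ∈ V(G2)` into a single vertex (namely `Sum.inl u1`). -/
noncomputable def joinAt {V1 V2 : Type*} (G1 : SimpleGraph V1) (G2 : SimpleGraph V2)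
    (u1 : V1) (u2 : V2) : SimpleGraph (V1 ⊕ {y : V2 // y ≠ u2}) :=
  SimpleGraph.fromRel (fun a b =>
    (∃ x y, G1.Adj x y ∧ a = Sum.inl x ∧ b = Sum.inl y) ∨
    (∃ x y, G2.Adj x y ∧ a = glueVert u1 u2 x ∧ b = glueVert u1 u2 y))


noncomputable def mE {V : Type*} [Fintype V] (G : SimpleGraph V) : ℕ := G.edgeFinset.card
noncomputable def DE {V : Type*} [Fintype V] (G : SimpleGraph V) (x : V) : ℕ :=
  ∑ f ∈ G.edgeFinset, vDist G x f
noncomputable def SE {V : Type*} [Fintype V] (G : SimpleGraph V) : ℕ :=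
  ∑ e ∈ G.edgeFinset, ∑ f ∈ G.edgeFinset, eDist G e f

lemma vDist_mk {V : Type*} (G : SimpleGraph V) (v x y : V) :
    vDist G v s(x, y) = min (G.dist v x) (G.dist v y) := by
  unfold vDist
  have : {n : ℕ | ∃ u ∈ s(x, y), G.dist v u = n} = {G.dist v x, G.dist v y} := by
    ext n; simp [eq_comm]
  rw [this, csInf_pair]

lemma eDist_mk {V : Type*} (G : SimpleGraph V) (x y z w : V) (h : s(x, y) ≠ s(z, w)) :
    eDist G s(x, y) s(z, w) =
      min (min (G.dist x z) (G.dist x w)) (min (G.dist y z) (G.dist y w)) + 1 := by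
  unfold eDist
  rw [if_neg h]
  have : {n : ℕ | ∃ u ∈ s(x, y), ∃ t ∈ s(z, w), G.dist u t = n} =
      {G.dist x z, G.dist x w} ∪ {G.dist y z, G.dist y w} := by
    ext n; simp [eq_comm, or_assoc]; tauto
  rw [this, csInf_union, csInf_pair, csInf_pair]
  all_goals first | exact OrderBot.bddBelow _ | simp

lemma eDist_comm' {V : Type*} (G : SimpleGraph V) (e f : Sym2 V) :
    eDist G e f = eDist G f e := by
  by_cases h : e = f
  · rw [h]
  · induction e using Sym2.ind with | _ x y =>
    induction f using Sym2.ind with | _ z w =>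
    rw [eDist_mk _ _ _ _ _ h, eDist_mk _ _ _ _ _ (Ne.symm h)]
    simp only [G.dist_comm (u := z), G.dist_comm (u := w)]
    omega

lemma lip_le {V : Type*} (G : SimpleGraph V) (φ : V → ℕ)
    (hφ : ∀ x y, G.Adj x y → φ y ≤ φ x + 1) (hG : G.Connected) (x y : V) :
    φ y ≤ φ x + G.dist x y := by
  obtain ⟨p, hp⟩ := hG.exists_walk_length_eq_dist x y
  rw [← hp]
  clear hp
  induction p with
  | nil => simp
  | cons h p ih => have := hφ _ _ h; simp only [Walk.length_cons]; omega

lemma adj_lip {V : Type*} (G : SimpleGraph V) (hG : G.Connected) (x y z : V) (h : G.Adj y z) :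
    G.dist x z ≤ G.dist x y + 1 := by
  have := hG.dist_triangle (u := x) (v := y) (w := z)
  rw [dist_eq_one_iff_adj.2 h] at this
  exact this

lemma hom_dist_le {V W : Type*} {G : SimpleGraph V} {H : SimpleGraph W} (f : G →g H)
    (hG : G.Connected) (x y : V) : H.dist (f x) (f y) ≤ G.dist x y := by
  obtain ⟨p, hp⟩ := hG.exists_walk_length_eq_dist x y
  rw [← hp, ← Walk.length_map f p]
  exact dist_le _

section join
variable {V W : Type*} {A : SimpleGraph V} {B : SimpleGraph W} {a : V} {b : W}

lemma glue_self : glueVert a b b = Sum.inl a := by simp [glueVert]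
lemma glue_ne {y : W} (h : y ≠ b) : glueVert a b y = Sum.inr ⟨y, h⟩ := by simp [glueVert, h]
lemma glue_inj : Function.Injective (glueVert a b) := by
  intro x y h
  by_cases hx : x = b <;> by_cases hy : y = b <;> simp_all [glueVert]
lemma glue_eq_inl {x : V} {y : W} (h : Sum.inl x = glueVert a b y) : x = a ∧ y = b := by
  by_cases hy : y = b <;> simp_all [glueVert]

lemma join_adj (p q : V ⊕ {y : W // y ≠ b}) : (joinAt A B a b).Adj p q ↔
    (∃ x y, A.Adj x y ∧ p = Sum.inl x ∧ q = Sum.inl y) ∨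
    (∃ x y, B.Adj x y ∧ p = glueVert a b x ∧ q = glueVert a b y) := by
  unfold joinAt
  rw [fromRel_adj]
  constructor
  · rintro ⟨_, (h | h) | ⟨x, y, h, h1, h2⟩ | ⟨x, y, h, h1, h2⟩⟩
    · exact Or.inl h
    · exact Or.inr h
    · exact Or.inl ⟨y, x, h.symm, h2, h1⟩
    · exact Or.inr ⟨y, x, h.symm, h2, h1⟩
  · intro h
    refine ⟨?_, Or.inl h⟩
    rcases h with ⟨x, y, h, rfl, rfl⟩ | ⟨x, y, h, rfl, rfl⟩
    · simpa using h.ne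
    · exact fun e => h.ne (glue_inj e)

noncomputable def homL (A : SimpleGraph V) (B : SimpleGraph W) (a : V) (b : W) : A →g joinAt A B a b :=
  ⟨Sum.inl, fun {x y} h => (join_adj _ _).2 (Or.inl ⟨x, y, h, rfl, rfl⟩)⟩
noncomputable def homR (A : SimpleGraph V) (B : SimpleGraph W) (a : V) (b : W) : B →g joinAt A B a b :=
  ⟨glueVert a b, fun {x y} h => (join_adj _ _).2 (Or.inr ⟨x, y, h, rfl, rfl⟩)⟩

lemma join_cases (p : V ⊕ {y : W // y ≠ b}) :
    (∃ x, p = Sum.inl x) ∨ (∃ y, p = glueVert a b y) := by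
  rcases p with x | ⟨y, hy⟩
  · exact Or.inl ⟨x, rfl⟩
  · exact Or.inr ⟨y, (glue_ne hy).symm⟩

lemma join_conn (hA : A.Connected) (hB : B.Connected) : (joinAt A B a b).Connected := by
  have key : ∀ p, (joinAt A B a b).Reachable (Sum.inl a) p := by
    intro p
    rcases join_cases (a := a) p with ⟨x, rfl⟩ | ⟨y, rfl⟩
    · exact (hA.preconnected a x).map (homL A B a b)
    · have := (hB.preconnected b y).map (homR A B a b)
      rw [← glue_self (a := a) (b := b)]
      exact this
  have : Nonempty (V ⊕ {y : W // y ≠ b}) := ⟨Sum.inl a⟩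
  exact ⟨fun p q => (key p).symm.trans (key q)⟩

/-- lipschitz potential -/
noncomputable def pot (b : W) (f : V → ℕ) (g : W → ℕ) : V ⊕ {y : W // y ≠ b} → ℕ :=
  Sum.elim f (fun y => g y.1)

lemma pot_glue {f : V → ℕ} {g : W → ℕ} (h : f a = g b) (y : W) :
    pot b f g (glueVert a b y) = g y := by
  by_cases hy : y = b
  · subst hy; rw [glue_self]; exact h
  · rw [glue_ne hy]; rfl

lemma pot_lip {f : V → ℕ} {g : W → ℕ} (h : f a = g b)
    (hf : ∀ x y, A.Adj x y → f y ≤ f x + 1) (hg : ∀ x y, B.Adj x y → g y ≤ g x + 1)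
    (p q) (hpq : (joinAt A B a b).Adj p q) : pot b f g q ≤ pot b f g p + 1 := by
  rcases (join_adj _ _).1 hpq with ⟨x, y, k, rfl, rfl⟩ | ⟨x, y, k, rfl, rfl⟩
  · exact hf _ _ k
  · rw [pot_glue h, pot_glue h]; exact hg _ _ k

variable (hA : A.Connected) (hB : B.Connected)

lemma dist_LL (hA : A.Connected) (hB : B.Connected) (x y : V) :
    (joinAt A B a b).dist (Sum.inl x) (Sum.inl y) = A.dist x y := by
  apply le_antisymm (hom_dist_le (homL A B a b) hA x y)
  have := lip_le _ _ (pot_lip (A := A) (B := B) (a := a) (b := b) (f := fun z => A.dist x z)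
    (g := fun z => A.dist x a + B.dist b z) (by simp) (fun y z h => adj_lip A hA x y z h)
    (fun y z h => by have := adj_lip B hB b y z h; omega)) (join_conn hA hB) (Sum.inl x) (Sum.inl y)
  simp only [pot, Sum.elim_inl, SimpleGraph.dist_self, zero_add] at this
  exact this

lemma dist_RR (hA : A.Connected) (hB : B.Connected) (x y : W) :
    (joinAt A B a b).dist (glueVert a b x) (glueVert a b y) = B.dist x y := by
  apply le_antisymm (hom_dist_le (homR A B a b) hB x y)
  have h0 : (fun z => B.dist x b + A.dist a z) a = (fun z => B.dist x z) b := by simp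
  have := lip_le _ _ (pot_lip (A := A) (B := B) (a := a) (b := b)
    (f := fun z => B.dist x b + A.dist a z) (g := fun z => B.dist x z) h0
    (fun y z h => by have := adj_lip A hA a y z h; omega)
    (fun y z h => adj_lip B hB x y z h)) (join_conn hA hB) (glueVert a b x) (glueVert a b y)
  rw [pot_glue (a := a) (b := b) (f := fun z => B.dist x b + A.dist a z) (g := fun z => B.dist x z) h0,
    pot_glue (a := a) (b := b) (f := fun z => B.dist x b + A.dist a z) (g := fun z => B.dist x z) h0] at this
  simp only [SimpleGraph.dist_self, zero_add] at this
  exact this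

lemma dist_LR (hA : A.Connected) (hB : B.Connected) (x : V) (y : W) :
    (joinAt A B a b).dist (Sum.inl x) (glueVert a b y) = A.dist x a + B.dist b y := by
  apply le_antisymm
  · have h1 := (join_conn (a := a) (b := b) hA hB).dist_triangle (u := Sum.inl x)
      (v := Sum.inl a) (w := glueVert a b y)
    rw [dist_LL hA hB] at h1
    conv at h1 => rhs; rhs; rw [← glue_self (a := a) (b := b)]
    rwa [dist_RR hA hB] at h1
  · have h0 : (fun z => A.dist x z) a = (fun z => A.dist x a + B.dist b z) b := by simp
    have := lip_le _ _ (pot_lip (A := A) (B := B) (a := a) (b := b)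
      (f := fun z => A.dist x z) (g := fun z => A.dist x a + B.dist b z) h0
      (fun y z h => adj_lip A hA x y z h)
      (fun y z h => by have := adj_lip B hB b y z h; omega)) (join_conn hA hB)
      (Sum.inl x) (glueVert a b y)
    rw [pot_glue (a := a) (b := b) (f := fun z => A.dist x z)
      (g := fun z => A.dist x a + B.dist b z) h0] at this
    simp only [pot, Sum.elim_inl, SimpleGraph.dist_self, zero_add] at this
    exact this

lemma vDist_map {X Y : Type*} {G : SimpleGraph X} {H : SimpleGraph Y} (f : X → Y) (v : Y) (c : ℕ)
    (w : X) (h : ∀ x, H.dist v (f x) = c + G.dist w x) (e : Sym2 X) :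
    vDist H v (e.map f) = c + vDist G w e := by
  induction e using Sym2.ind with | _ x y =>
  rw [Sym2.map_mk, vDist_mk, vDist_mk, h, h]; omega

lemma eDist_map {X Y : Type*} {G : SimpleGraph X} {H : SimpleGraph Y} (f : X → Y)
    (hf : Function.Injective f)
    (h : ∀ x y, H.dist (f x) (f y) = G.dist x y) (e e' : Sym2 X) :
    eDist H (e.map f) (e'.map f) = eDist G e e' := by
  by_cases hee : e = e'
  · simp [eDist, hee]
  have h' : e.map f ≠ e'.map f := fun k => hee (Sym2.map.injective hf k)
  induction e using Sym2.ind with | _ x y =>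
  induction e' using Sym2.ind with | _ z w =>
  rw [Sym2.map_mk, Sym2.map_mk] at h' ⊢
  rw [eDist_mk _ _ _ _ _ h', eDist_mk _ _ _ _ _ hee]
  simp only [h]

lemma cross_ne (e : Sym2 V) (f : Sym2 W) (he : e ∈ A.edgeSet) :
    e.map Sum.inl ≠ f.map (glueVert a b) := by
  induction e using Sym2.ind with | _ x y =>
  induction f using Sym2.ind with | _ z w =>
  intro h
  rw [Sym2.map_mk, Sym2.map_mk, Sym2.eq_iff] at h
  have hxy : x ≠ y := Adj.ne he
  rcases h with ⟨h1, h2⟩ | ⟨h1, h2⟩ <;>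
  exact hxy ((glue_eq_inl h1).1.trans (glue_eq_inl h2).1.symm)

lemma eDist_LR (hA : A.Connected) (hB : B.Connected) (e : Sym2 V) (f : Sym2 W)
    (he : e ∈ A.edgeSet) :
    eDist (joinAt A B a b) (e.map Sum.inl) (f.map (glueVert a b)) =
      vDist A a e + vDist B b f + 1 := by
  have h' := cross_ne (a := a) (b := b) e f he
  induction e using Sym2.ind with | _ x y =>
  induction f using Sym2.ind with | _ z w =>
  rw [Sym2.map_mk, Sym2.map_mk] at h' ⊢
  rw [eDist_mk _ _ _ _ _ h', vDist_mk, vDist_mk]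
  simp only [dist_LR hA hB]
  rw [A.dist_comm (u := x), A.dist_comm (u := y)]
  omega

variable [Fintype V] [Fintype W] [Fintype (V ⊕ {y : W // y ≠ b})]

lemma join_sum (F : Sym2 (V ⊕ {y : W // y ≠ b}) → ℕ) :
    ∑ e ∈ (joinAt A B a b).edgeFinset, F e =
      ∑ e ∈ A.edgeFinset, F (e.map Sum.inl) + ∑ e ∈ B.edgeFinset, F (e.map (glueVert a b)) := by
  have h : (joinAt A B a b).edgeFinset = A.edgeFinset.image (Sym2.map Sum.inl) ∪
      B.edgeFinset.image (Sym2.map (glueVert a b)) := by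
    ext e
    induction e using Sym2.ind with | _ p q =>
    simp only [mem_edgeFinset, mem_edgeSet, Finset.mem_union, Finset.mem_image, join_adj]
    constructor
    · rintro (⟨x, y, h, rfl, rfl⟩ | ⟨x, y, h, rfl, rfl⟩)
      · exact Or.inl ⟨s(x, y), h, rfl⟩
      · exact Or.inr ⟨s(x, y), h, rfl⟩
    · rintro (⟨e, h, h2⟩ | ⟨e, h, h2⟩) <;> induction e using Sym2.ind with | _ x y => ?_
      · rw [Sym2.map_mk, Sym2.eq_iff] at h2
        rcases h2 with ⟨rfl, rfl⟩ | ⟨rfl, rfl⟩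
        · exact Or.inl ⟨x, y, h, rfl, rfl⟩
        · exact Or.inl ⟨y, x, h.symm, rfl, rfl⟩
      · rw [Sym2.map_mk, Sym2.eq_iff] at h2
        rcases h2 with ⟨rfl, rfl⟩ | ⟨rfl, rfl⟩
        · exact Or.inr ⟨x, y, h, rfl, rfl⟩
        · exact Or.inr ⟨y, x, h.symm, rfl, rfl⟩
  rw [h, Finset.sum_union, Finset.sum_image, Finset.sum_image]
  · exact fun _ _ _ _ h => Sym2.map.injective glue_inj h
  · exact fun _ _ _ _ h => Sym2.map.injective Sum.inl_injective h
  · rw [Finset.disjoint_left]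
    intro e h1 h2
    obtain ⟨e1, h1', rfl⟩ := Finset.mem_image.1 h1
    obtain ⟨e2, h2', h3⟩ := Finset.mem_image.1 h2
    exact cross_ne e1 e2 (mem_edgeFinset.1 h1') h3.symm

lemma mE_join : mE (joinAt A B a b) = mE A + mE B := by
  unfold mE
  simp only [Finset.card_eq_sum_ones]
  exact join_sum (fun _ => 1)

lemma DE_inl (hA : A.Connected) (hB : B.Connected) (x : V) :
    DE (joinAt A B a b) (Sum.inl x) = DE A x + (mE B * A.dist x a + DE B b) := by
  unfold DE mE
  rw [join_sum]
  congr 1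
  · refine Finset.sum_congr rfl fun e _ => ?_
    rw [vDist_map (G := A) Sum.inl _ 0 x (fun y => by rw [dist_LL hA hB]; simp), zero_add]
  · rw [Finset.sum_congr rfl fun e _ =>
      vDist_map (G := B) _ _ (A.dist x a) b (fun y => dist_LR hA hB x y) e]
    simp [Finset.sum_add_distrib]

lemma DE_glue (hA : A.Connected) (hB : B.Connected) (y : W) :
    DE (joinAt A B a b) (glueVert a b y) = (mE A * B.dist b y + DE A a) + DE B y := by
  unfold DE mE
  rw [join_sum]
  congr 1
  · rw [Finset.sum_congr rfl fun e _ =>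
      vDist_map (G := A) Sum.inl _ (B.dist b y) a (fun z => by
        rw [SimpleGraph.dist_comm, dist_LR hA hB, A.dist_comm]; omega) e]
    simp [Finset.sum_add_distrib]
  · refine Finset.sum_congr rfl fun e _ => ?_
    rw [vDist_map (G := B) _ _ 0 y (fun y => by rw [dist_RR hA hB]; simp), zero_add]

lemma cross_sum (hA : A.Connected) (hB : B.Connected) :
    ∑ e ∈ A.edgeFinset, ∑ f ∈ B.edgeFinset,
      eDist (joinAt A B a b) (e.map Sum.inl) (f.map (glueVert a b)) =
      mE B * DE A a + mE A * DE B b + mE A * mE B := by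
  rw [Finset.sum_congr rfl fun e he => Finset.sum_congr rfl fun f _ =>
    eDist_LR hA hB e f (mem_edgeFinset.1 he)]
  simp [Finset.sum_add_distrib, mE, DE, ← Finset.mul_sum]

lemma SE_join (hA : A.Connected) (hB : B.Connected) :
    SE (joinAt A B a b) = SE A + SE B + 2 * (mE B * DE A a + mE A * DE B b + mE A * mE B) := by
  have h1 : ∑ e ∈ B.edgeFinset, ∑ f ∈ A.edgeFinset,
      eDist (joinAt A B a b) (e.map (glueVert a b)) (f.map Sum.inl) =
      mE B * DE A a + mE A * DE B b + mE A * mE B := by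
    rw [Finset.sum_comm, ← cross_sum hA hB]
    exact Finset.sum_congr rfl fun e _ => Finset.sum_congr rfl fun f _ => eDist_comm' _ _ _
  unfold SE
  rw [join_sum]
  simp only [join_sum, Finset.sum_add_distrib]
  rw [cross_sum hA hB, h1]
  simp only [eDist_map (G := A) (H := joinAt A B a b) Sum.inl Sum.inl_injective (dist_LL hA hB),
    eDist_map (G := B) (H := joinAt A B a b) _ glue_inj (dist_RR hA hB)]
  ring

end join

lemma DE_iso {V : Type*} [Fintype V] (G : SimpleGraph V) (hG : G.Connected) (φ : G ≃g G) (x : V) :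
    DE G (φ x) = DE G x := by
  have hd : ∀ x y, G.dist (φ x) (φ y) = G.dist x y := by
    intro x y
    apply le_antisymm (hom_dist_le φ.toHom hG x y)
    have := hom_dist_le φ.symm.toHom hG (φ x) (φ y)
    simpa using this
  unfold DE
  symm
  refine Finset.sum_bij (fun e _ => e.map φ) ?_ ?_ ?_ ?_
  · intro e he
    induction e using Sym2.ind with | _ a b =>
    exact mem_edgeFinset.2 (φ.map_adj_iff.2 (mem_edgeFinset.1 he))
  · exact fun _ _ _ _ h => Sym2.map.injective φ.injective h
  · intro e he
    refine ⟨e.map φ.symm, ?_, ?_⟩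
    · induction e using Sym2.ind with | _ a b =>
      exact mem_edgeFinset.2 (φ.symm.map_adj_iff.2 (mem_edgeFinset.1 he))
    · induction e using Sym2.ind with | _ a b => simp
  · intro e _
    rw [vDist_map (G := G) φ (φ x) 0 x (by simp [hd]), zero_add]

def revIso (s : ℕ) : pathGraph s ≃g pathGraph s where
  toEquiv := Fin.revPerm
  map_rel_iff' := by
    intro a b
    simp only [pathGraph_adj, Fin.revPerm_apply, Fin.val_rev]
    omega

lemma mE_path (k : ℕ) : mE (pathGraph (k + 1)) ≤ k := by
  unfold mE
  have : (pathGraph (k + 1)).edgeFinset ⊆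
      (Finset.univ : Finset (Fin k)).image (fun i => s(i.castSucc, i.succ)) := by
    intro e he
    induction e using Sym2.ind with | _ a b =>
    rw [mem_edgeFinset, mem_edgeSet, pathGraph_adj] at he
    rw [Finset.mem_image]
    rcases he with h | h
    · refine ⟨⟨a.1, by omega⟩, Finset.mem_univ _, ?_⟩
      rw [Sym2.eq_iff]; left
      constructor <;> ext <;> simp [h]
    · refine ⟨⟨b.1, by omega⟩, Finset.mem_univ _, ?_⟩
      rw [Sym2.eq_iff]; right
      constructor <;> ext <;> simp [h]
  refine (Finset.card_le_card this).trans (Finset.card_image_le.trans (by simp))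

lemma dist_path (k : ℕ) (a b : Fin (k + 1)) : b.val ≤ a.val + (pathGraph (k + 1)).dist a b :=
  lip_le _ (fun i => i.val) (fun x y h => by rw [pathGraph_adj] at h; omega)
    (pathGraph_connected k) a b

lemma dist_lt_mE {V : Type*} [Fintype V] (G : SimpleGraph V) (hG : G.Connected)
    (hn : ∀ n : ℕ, IsEmpty (G ≃g pathGraph n)) (u v : V) : G.dist u v < mE G := by
  by_contra hlt
  push Not at hlt
  have hcard : Fintype.card V ≤ mE G + 1 := by
    have := hG.card_vert_le_card_edgeSet_add_one
    rwa [Nat.card_eq_fintype_card, Nat.card_eq_fintype_card, ← edgeFinset_card] at this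
  obtain ⟨p, hp⟩ := hG.exists_walk_length_eq_dist u v
  have hpath := p.isPath_of_length_eq_dist hp
  have hinj : Function.Injective (fun i : Fin (p.length + 1) => p.getVert i) := by
    intro i j h
    have := hpath.getVert_injOn (by simp; omega) (by simp; omega) h
    exact Fin.ext this
  have hbij : Function.Bijective (fun i : Fin (p.length + 1) => p.getVert i) := by
    rw [Fintype.bijective_iff_injective_and_card]
    refine ⟨hinj, le_antisymm (Fintype.card_le_of_injective _ hinj) ?_⟩
    rw [Fintype.card_fin]; omega
  have hdist : ∀ i, i ≤ p.length → G.dist u (p.getVert i) = i := by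
    intro i hi
    have h1 := dist_le (p.take i)
    have h2 := dist_le (p.drop i)
    have h3 := hG.dist_triangle (u := u) (v := p.getVert i) (w := v)
    rw [Walk.take_length] at h1
    rw [Walk.drop_length] at h2
    omega
  refine (hn (p.length + 1)).false (SimpleGraph.Iso.symm ⟨Equiv.ofBijective _ hbij, ?_⟩)
  intro i j
  simp only [Equiv.ofBijective_apply, pathGraph_adj]
  constructor
  · intro h
    have h1 := adj_lip G hG u _ _ h
    have h2 := adj_lip G hG u _ _ h.symm
    rw [hdist _ (by omega), hdist _ (by omega)] at h1 h2
    have : i.val ≠ j.val := fun e => h.ne (by rw [e])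
    omega
  · rintro (h | h)
    · have := p.adj_getVert_succ (i := i.val) (by omega)
      rwa [h] at this
    · have := p.adj_getVert_succ (i := j.val) (by omega)
      rw [h] at this
      exact this.symm

theorem stmt10 {V1 V2 : Type*} [Fintype V1] [Fintype V2]
    (G1 : SimpleGraph V1) (G2 : SimpleGraph V2)
    (h1 : G1.Connected) (h2 : G2.Connected)
    (hn1 : 2 ≤ Fintype.card V1) (hm1 : 1 ≤ G1.edgeFinset.card)
    (hnotpath : ∀ n : ℕ, IsEmpty (G2 ≃g SimpleGraph.pathGraph n))
    (u v : V2) (u1 : V1)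
    (hlongest : ∃ p : G2.Walk u v, p.IsPath ∧
      ∀ (a b : V2) (q : G2.Walk a b), q.IsPath → q.length ≤ p.length)
    (hD : ∑ f ∈ G2.edgeFinset, vDist G2 u f ≤ ∑ f ∈ G2.edgeFinset, vDist G2 v f)
    (s : ℕ) (hs : 2 ≤ s) :
    edgeWiener (joinAt (joinAt G2 G1 u u1) (SimpleGraph.pathGraph s)
        (Sum.inl v) (⟨0, by omega⟩ : Fin s))
      < edgeWiener (joinAt (joinAt G1 (SimpleGraph.pathGraph s) u1 (⟨0, by omega⟩ : Fin s)) G2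
        (Sum.inr ⟨⟨s - 1, by omega⟩, by simp only [ne_eq, Fin.mk.injEq]; omega⟩) v) := by
  obtain ⟨k, rfl⟩ : ∃ k, s = k + 1 := ⟨s - 1, by omega⟩
  have hP := pathGraph_connected k
  have hd := dist_lt_mE G2 h2 hnotpath u v
  have hmP := mE_path k
  have hdP := dist_path k ⟨0, by omega⟩ ⟨k, by omega⟩
  have hiso := DE_iso _ hP (revIso (k + 1)) ⟨0, by omega⟩
  have hrev : (revIso (k + 1)) ⟨0, by omega⟩ = (⟨k, by omega⟩ : Fin (k + 1)) := by
    ext; simp [revIso]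
  rw [hrev] at hiso
  have hg : (Sum.inr ⟨(⟨k + 1 - 1, by omega⟩ : Fin (k + 1)),
      by simp only [ne_eq, Fin.mk.injEq]; omega⟩ :
      V1 ⊕ {y : Fin (k + 1) // y ≠ (⟨0, by omega⟩ : Fin (k + 1))}) =
      glueVert u1 (⟨0, by omega⟩ : Fin (k + 1)) ⟨k, by omega⟩ := by
    rw [glue_ne (by simp only [ne_eq, Fin.mk.injEq]; omega)]; rfl
  rw [hg]
  have hD' : DE G2 u ≤ DE G2 v := hD
  have hm1' : 1 ≤ mE G1 := hm1
  suffices h : SE (joinAt (joinAt G2 G1 u u1) (SimpleGraph.pathGraph (k + 1))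
        (Sum.inl v) (⟨0, by omega⟩ : Fin (k + 1))) + 2 ≤
      SE (joinAt (joinAt G1 (SimpleGraph.pathGraph (k + 1)) u1 (⟨0, by omega⟩ : Fin (k + 1))) G2
        (glueVert u1 (⟨0, by omega⟩ : Fin (k + 1)) ⟨k, by omega⟩) v) by
    unfold edgeWiener
    unfold SE at h
    omega
  rw [SE_join (join_conn h2 h1) hP, SE_join h2 h1, SE_join (join_conn h1 hP) h2, SE_join h1 hP,
    mE_join, mE_join, DE_inl h2 h1, DE_glue h1 hP, hiso, G2.dist_comm]
  simp only [zero_add] at hdP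
  generalize (pathGraph (k + 1)).dist _ _ = L at *
  generalize G2.dist u v = d at *
  generalize SE G1 = S1
  generalize SE G2 = S2
  generalize SE (pathGraph (k + 1)) = S3
  generalize DE (pathGraph (k + 1)) _ = D3
  generalize DE G1 u1 = D1
  generalize DE G2 u = Du at *
  generalize DE G2 v = Dv at *
  generalize mE G1 = m1 at *
  generalize mE G2 = m2 at *
  generalize mE (pathGraph (k + 1)) = e at *
  have k1 : m1 * Du ≤ m1 * Dv := Nat.mul_le_mul_left _ hD'
  have k2 : e * (m1 * d) + 1 ≤ m2 * (m1 * L) := by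
    have a1 : e * (m1 * d) ≤ L * (m1 * d) := Nat.mul_le_mul_right _ (by omega)
    have a2 : L * m1 * (d + 1) ≤ L * m1 * m2 := Nat.mul_le_mul_left _ hd
    have a3 : 1 ≤ L * m1 := Nat.mul_pos (by omega) hm1'
    nlinarith
  nlinarith
end
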